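/- Let (A,B) be a random vector such that A satisfies Assumption (A3) with parameters κ > 0, θ ∈ (0,1) and h > 0, and E[|B|^ν] < ∞ for some ν > κ. Let X be a random variable independent of (A,B) whose distribution satisfies the maximum equation X =_d max(AX, B). Then there exists a function q ∈ 𝒬(κ,h) such that lim_{n→∞} p_n^{−1} x^κ e^{κnh} P(X > x e^{nh}) = q(x) for every continuity point x > 0 of q, where p_n = F_κ(nh) − F_κ(nh−). Moreover, if B ≥ 0 a.s. and P(B > 0) > 0, then q(x) > 0 for all x > 0. -/

import Mathlib

open MeasureTheory ProbabilityTheory Filter Topology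

noncomputable section

/-- `q ∈ 𝒬(κ,h)`: `q : (0,∞) → [0,∞)`, `x ↦ x^{-κ} q(x)` is nonincreasing on `(0,∞)`,
and `q(x e^h) = q(x)` for all `x > 0`. -/
def MemQ (κ h : ℝ) (q : ℝ → ℝ) : Prop :=
  (∀ x : ℝ, 0 < x → 0 ≤ q x) ∧
  AntitoneOn (fun x : ℝ => x ^ (-κ) * q x) (Set.Ioi (0 : ℝ)) ∧
  (∀ x : ℝ, 0 < x → q (x * Real.exp h) = q x)

/-- The conditional distribution of `log A` given `A ≠ 0` is arithmetic with span `h`. -/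
def CondLogArithSpan {Ω : Type*} [MeasurableSpace Ω] (P : Measure Ω) (A : Ω → ℝ)
    (h : ℝ) : Prop :=
  0 < h ∧
  P {ω | A ω ≠ 0 ∧ ∀ k : ℤ, Real.log (A ω) ≠ (k : ℝ) * h} = 0 ∧
  ∀ h' : ℝ, 0 < h' →
    P {ω | A ω ≠ 0 ∧ ∀ k : ℤ, Real.log (A ω) ≠ (k : ℝ) * h'} = 0 → h' ≤ h

/-- The exponentially tilted distribution of `log A`: the measure `C ↦ E[1{log A ∈ C} A^κ]`
(the integrand vanishing on `{A = 0}` since `κ > 0`); it has total mass `E A^κ = θ`. -/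
def tiltedLog {Ω : Type*} [MeasurableSpace Ω] (P : Measure Ω) (A : Ω → ℝ)
    (κ : ℝ) : Measure ℝ :=
  Measure.map (fun ω => Real.log (A ω)) (P.withDensity fun ω => ENNReal.ofReal (A ω ^ κ))

/-- The normalized tilted distribution, with distribution function
`F_κ(x) = θ⁻¹ E[1{log A ≤ x} A^κ]`. -/
def normTilted {Ω : Type*} [MeasurableSpace Ω] (P : Measure Ω) (A : Ω → ℝ)
    (κ θ : ℝ) : Measure ℝ :=
  (ENNReal.ofReal θ)⁻¹ • tiltedLog P A κ

/-- Convolution of two measures on `ℝ`. -/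
def mconv (μ ν : Measure ℝ) : Measure ℝ :=
  Measure.map (fun p : ℝ × ℝ => p.1 + p.2) (μ.prod ν)

/-- The point masses `p_k = F_κ(kh) - F_κ(kh-)` of the normalized tilted distribution. -/
def pA3 {Ω : Type*} [MeasurableSpace Ω] (P : Measure Ω) (A : Ω → ℝ)
    (κ θ h : ℝ) (k : ℤ) : ℝ :=
  (normTilted P A κ θ (Set.Iic ((k : ℝ) * h))).toReal -
    (normTilted P A κ θ (Set.Iio ((k : ℝ) * h))).toReal

/-- The point masses `p_k^{*2} = (F_κ*F_κ)(kh) - (F_κ*F_κ)(kh-)`. -/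
def p2A3 {Ω : Type*} [MeasurableSpace Ω] (P : Measure Ω) (A : Ω → ℝ)
    (κ θ h : ℝ) (k : ℤ) : ℝ :=
  (mconv (normTilted P A κ θ) (normTilted P A κ θ) (Set.Iic ((k : ℝ) * h))).toReal -
    (mconv (normTilted P A κ θ) (normTilted P A κ θ) (Set.Iio ((k : ℝ) * h))).toReal

/-- Assumption (A3): `A ≥ 0` a.s., `E A^κ = θ ∈ (0,1)`, `log A | A ≠ 0` arithmetic with
span `h`, the normalized tilted distribution function `F_κ` is `h`-subexponential
(`p_{n+1}/p_n → 1` and `p_n^{*2}/p_n → 2`), and `sup_{k ≥ n} p_k = O(p_n)`. -/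
def AssumptionA3 {Ω : Type*} [MeasurableSpace Ω] (P : Measure Ω) (A : Ω → ℝ)
    (κ θ h : ℝ) : Prop :=
  0 < κ ∧ 0 < θ ∧ θ < 1 ∧ (∀ᵐ ω ∂P, 0 ≤ A ω) ∧ (∫ ω, A ω ^ κ ∂P) = θ ∧
  CondLogArithSpan P A h ∧
  Tendsto (fun n : ℕ => pA3 P A κ θ h (n + 1) / pA3 P A κ θ h n) atTop (𝓝 1) ∧
  Tendsto (fun n : ℕ => p2A3 P A κ θ h n / pA3 P A κ θ h n) atTop (𝓝 2) ∧
  ∃ C : ℝ, ∀ᶠ n : ℕ in atTop, ∀ k : ℕ, n ≤ k → pA3 P A κ θ h k ≤ C * pA3 P A κ θ h n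


open scoped ENNReal

/-- Two-sided locally subexponential probability sequences with almost decreasing right tail. -/
structure LocallySubexponential (p : ℤ → ℝ) : Prop where
  nonneg : ∀ n, 0 ≤ p n
  hasSum_one : HasSum p 1
  ratio : Tendsto (fun n : ℤ => p (n + 1) / p n) atTop (𝓝 1)
  conv : Tendsto (fun n : ℤ => (∑' i, p i * p (n - i)) / p n) atTop (𝓝 2)
  almost_decreasing : ∃ C : ℝ, ∀ᶠ n : ℤ in atTop, ∀ k, n ≤ k → p k ≤ C * p n

namespace LocallySubexponential

variable {p : ℤ → ℝ}

lemma eventually_pos (hp : LocallySubexponential p) : ∀ᶠ n in atTop, 0 < p n := by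
  have := hp.ratio.eventually_ne one_ne_zero
  filter_upwards [this] with n hn
  refine lt_of_le_of_ne (hp.nonneg n) fun h => hn ?_
  rw [← h, div_zero]

lemma le_one (hp : LocallySubexponential p) (n : ℤ) : p n ≤ 1 :=
  le_hasSum hp.hasSum_one n fun i _ => hp.nonneg i

lemma shift_nat (hp : LocallySubexponential p) (k : ℕ) :
    Tendsto (fun n : ℤ => p (n + k) / p n) atTop (𝓝 1) := by
  induction k with
  | zero =>
    refine tendsto_const_nhds.congr' ?_
    filter_upwards [hp.eventually_pos] with n hn
    simp [hn.ne']
  | succ k ih =>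
    have h1 : Tendsto (fun n : ℤ => n + 1) atTop atTop := tendsto_atTop_add_const_right _ _ tendsto_id
    have h2 := (ih.comp h1).mul hp.ratio
    rw [one_mul] at h2
    refine h2.congr' ?_
    filter_upwards [h1.eventually hp.eventually_pos] with n hn
    simp only [Function.comp]
    rw [div_mul_div_cancel₀ hn.ne']
    congr 2
    push_cast; ring

lemma shift (hp : LocallySubexponential p) (k : ℤ) :
    Tendsto (fun n : ℤ => p (n - k) / p n) atTop (𝓝 1) := by
  rcases le_total k 0 with hk | hk
  · obtain ⟨m, hm⟩ := Int.exists_eq_neg_ofNat hk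
    subst hm
    simpa using hp.shift_nat m
  · lift k to ℕ using hk
    have h1 : Tendsto (fun n : ℤ => n - k) atTop atTop := by
      simpa [sub_eq_add_neg] using tendsto_atTop_add_const_right atTop (-(k : ℤ)) tendsto_id
    have h2 := ((hp.shift_nat k).comp h1).inv₀ one_ne_zero
    simpa [Function.comp_def] using h2

lemma shift_bound (hp : LocallySubexponential p) (M : ℤ) :
    ∃ C : ℝ, 0 ≤ C ∧ ∀ᶠ n in atTop, ∀ i ≤ M, p (n - i) ≤ C * p n := by
  obtain ⟨C, hC⟩ := hp.almost_decreasing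
  have h1 : Tendsto (fun n : ℤ => n - M) atTop atTop := by
    simpa [sub_eq_add_neg] using tendsto_atTop_add_const_right atTop (-M) tendsto_id
  refine ⟨|C| * 2, by positivity, ?_⟩
  filter_upwards [h1.eventually hC, (hp.shift M).eventually_le_const one_lt_two,
    hp.eventually_pos] with n h2 h3 h4 i hi
  rw [div_le_iff₀ h4] at h3
  calc p (n - i) ≤ C * p (n - M) := h2 _ (by omega)
    _ ≤ |C| * p (n - M) := by gcongr; exacts [hp.nonneg _, le_abs_self C]
    _ ≤ |C| * (2 * p n) := by gcongr
    _ = _ := by ring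

lemma summable_mul_shift (hp : LocallySubexponential p) {F : ℤ → ℝ} (hF : Summable F) (n : ℤ) :
    Summable fun i => F i * p (n - i) := by
  refine Summable.of_norm_bounded hF.norm fun i => ?_
  rw [norm_mul]
  refine mul_le_of_le_one_right (norm_nonneg _) ?_
  rw [Real.norm_of_nonneg (hp.nonneg _)]
  exact hp.le_one _

/-- Convolving with a summable sequence supported on a left half-line. -/
lemma tendsto_conv_left (hp : LocallySubexponential p) {F : ℤ → ℝ} (hF : Summable F) (M : ℤ) :
    Tendsto (fun n => (∑' i, (Set.Iic M).indicator F i * p (n - i)) / p n) atTop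
      (𝓝 (∑' i, (Set.Iic M).indicator F i)) := by
  obtain ⟨C, hC0, hC⟩ := hp.shift_bound M
  simp_rw [← tsum_div_const]
  have hb : Summable fun i => ‖(Set.Iic M).indicator F i‖ * C := (hF.indicator _).norm.mul_right C
  refine tendsto_tsum_of_dominated_convergence hb (fun i => ?_) ?_
  · simpa [mul_div_assoc] using (hp.shift i).const_mul ((Set.Iic M).indicator F i)
  · filter_upwards [hC, hp.eventually_pos] with n hn hn0 i
    rw [mul_div_assoc, norm_mul]
    by_cases hi : i ≤ M
    · gcongr
      rw [Real.norm_of_nonneg (div_nonneg (hp.nonneg _) hn0.le), div_le_iff₀ hn0]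
      exact hn i hi
    · simp [hi]

lemma tendsto_partial {F : ℤ → ℝ} (hF : Summable F) :
    Tendsto (fun M : ℤ => ∑' i, (Set.Iic M).indicator F i) atTop (𝓝 (∑' i, F i)) := by
  refine tendsto_tsum_of_dominated_convergence hF.norm (fun i => ?_) ?_
  · refine tendsto_const_nhds.congr' ?_
    filter_upwards [eventually_ge_atTop i] with M hM
    simp [hM]
  · exact Eventually.of_forall fun M i => norm_indicator_le_norm_self _ _

lemma tendsto_conv_right (hp : LocallySubexponential p) (M : ℤ) :
    Tendsto (fun n => (∑' i, (Set.Ioi M).indicator p i * p (n - i)) / p n) atTop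
      (𝓝 (2 - ∑' i, (Set.Iic M).indicator p i)) := by
  have hs := hp.hasSum_one.summable
  refine (hp.conv.sub (hp.tendsto_conv_left hs M)).congr fun n => ?_
  rw [← sub_div, ← (hp.summable_mul_shift hs n).tsum_sub
    (hp.summable_mul_shift (hs.indicator _) n)]
  congr 2 with i
  by_cases hi : i ≤ M
  · simp [hi]
  · simp [hi, not_le.mp hi]

end LocallySubexponential

namespace LocallySubexponential

variable {p : ℤ → ℝ} {θ : ℝ} {b : ℤ → ℝ}

/-- One step of the iteration `V ↦ θ p * V + b`. -/
def renewalStep (p : ℤ → ℝ) (θ : ℝ) (b : ℤ → ℝ) (V : ℤ → ℝ≥0∞) (n : ℤ) : ℝ≥0∞ :=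
  ∑' i, ENNReal.ofReal (θ * p (n - i)) * V i + ENNReal.ofReal (b n)

lemma tsum_ofReal_shift (hp : LocallySubexponential p) (hθ : 0 ≤ θ) (i : ℤ) :
    ∑' n, ENNReal.ofReal (θ * p (n - i)) = ENNReal.ofReal θ := by
  have h1 := (Equiv.subRight i).tsum_eq fun n => ENNReal.ofReal (θ * p n)
  simp only [Equiv.subRight_apply] at h1
  rw [h1, ← ENNReal.ofReal_tsum_of_nonneg (fun n => mul_nonneg hθ (hp.nonneg n))
    (hp.hasSum_one.summable.mul_left θ), tsum_mul_left, hp.hasSum_one.tsum_eq, mul_one]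

lemma tsum_ofReal_reflect (hp : LocallySubexponential p) (hθ : 0 ≤ θ) (n : ℤ) :
    ∑' i, ENNReal.ofReal (θ * p (n - i)) = ENNReal.ofReal θ := by
  have h1 := (Equiv.subLeft n).tsum_eq fun n => ENNReal.ofReal (θ * p n)
  simp only [Equiv.subLeft_apply] at h1
  rw [h1, ← ENNReal.ofReal_tsum_of_nonneg (fun n => mul_nonneg hθ (hp.nonneg n))
    (hp.hasSum_one.summable.mul_left θ), tsum_mul_left, hp.hasSum_one.tsum_eq, mul_one]

lemma tsum_renewalStep_le (hp : LocallySubexponential p) (hθ : 0 ≤ θ) (hθ1 : θ < 1)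
    (hb0 : ∀ n, 0 ≤ b n) (hbs : Summable b) {V : ℤ → ℝ≥0∞}
    (hV : ∑' n, V n ≤ ENNReal.ofReal ((∑' n, b n) / (1 - θ))) :
    ∑' n, renewalStep p θ b V n ≤ ENNReal.ofReal ((∑' n, b n) / (1 - θ)) := by
  have hT : 0 ≤ (∑' n, b n) / (1 - θ) := div_nonneg (tsum_nonneg hb0) (by linarith)
  unfold renewalStep
  rw [ENNReal.tsum_add, ENNReal.tsum_comm]
  simp_rw [ENNReal.tsum_mul_right, hp.tsum_ofReal_shift hθ, ENNReal.tsum_mul_left]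
  rw [← ENNReal.ofReal_tsum_of_nonneg hb0 hbs]
  calc _ ≤ ENNReal.ofReal θ * ENNReal.ofReal ((∑' n, b n) / (1 - θ)) +
        ENNReal.ofReal (∑' n, b n) := by gcongr
    _ = _ := by
      rw [← ENNReal.ofReal_mul hθ, ← ENNReal.ofReal_add (by positivity) (tsum_nonneg hb0)]
      congr 1
      have : 1 - θ ≠ 0 := by linarith
      field_simp
      ring

/-- A Kesten-type bound: the iteration `V ↦ θ p * V + b` preserves a set of summable sequences
that are uniformly of order `p n` on the right. -/
lemma exists_invariant_bound (hp : LocallySubexponential p) (hθ : 0 < θ) (hθ1 : θ < 1)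
    (hb0 : ∀ n, 0 ≤ b n) (hbs : Summable b)
    (hbp : Tendsto (fun n => b n / p n) atTop (𝓝 0)) :
    ∃ C : ℝ, ∃ M : ℤ, ∀ V : ℤ → ℝ≥0∞,
      ∑' n, V n ≤ ENNReal.ofReal ((∑' n, b n) / (1 - θ)) →
      (∀ n, M < n → V n ≤ ENNReal.ofReal (C * p n)) →
      ∀ n, M < n → renewalStep p θ b V n ≤ ENNReal.ofReal (C * p n) := by
  set T := (∑' n, b n) / (1 - θ) with hTdef
  have hT : 0 ≤ T := div_nonneg (tsum_nonneg hb0) (by linarith)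
  obtain ⟨r, hr1, hθr⟩ : ∃ r : ℝ, 1 < r ∧ θ * r < 1 := by
    have := one_lt_inv₀ hθ |>.2 hθ1
    obtain ⟨r, h1, h2⟩ := exists_between this
    refine ⟨r, h1, ?_⟩
    calc θ * r < θ * θ⁻¹ := by gcongr
      _ = 1 := mul_inv_cancel₀ hθ.ne'
  have hs := hp.hasSum_one.summable
  have hpart : Tendsto (fun M : ℤ => 2 - ∑' i, (Set.Iic M).indicator p i) atTop (𝓝 1) := by
    have := (tendsto_partial hs).const_sub 2
    rw [hp.hasSum_one.tsum_eq] at this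
    norm_num at this
    exact this
  obtain ⟨M, hM1, hM2⟩ := ((hpart.eventually_lt_const hr1).and
    (eventually_forall_ge_atTop.2 hp.eventually_pos)).exists
  obtain ⟨C₁, hC₁, hC₁'⟩ := hp.shift_bound M
  obtain ⟨N, hN⟩ := eventually_atTop.1 (hC₁'.and
    (((hp.tendsto_conv_right M).eventually_lt_const hM1).and
      (hbp.eventually_lt_const one_pos)))
  set c := ∑ n ∈ Finset.Ioc M N, T / p n with hc
  have hc0 : 0 ≤ c := Finset.sum_nonneg fun n _ => div_nonneg hT (hp.nonneg n)
  have h1r : 0 < 1 - θ * r := by linarith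
  refine ⟨c + (θ * (C₁ * T) + 1) / (1 - θ * r), M, fun V hV1 hV2 n hn => ?_⟩
  set C := c + (θ * (C₁ * T) + 1) / (1 - θ * r) with hC
  have hC0 : 0 ≤ C := by positivity
  have hpn := hM2 n hn.le
  rcases le_or_gt n N with hnN | hnN
  · calc renewalStep p θ b V n ≤ ∑' n, renewalStep p θ b V n := ENNReal.le_tsum n
      _ ≤ ENNReal.ofReal T := hp.tsum_renewalStep_le hθ.le hθ1 hb0 hbs hV1
      _ ≤ ENNReal.ofReal (C * p n) := by
        apply ENNReal.ofReal_le_ofReal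
        have h2 : T / p n ≤ c := Finset.single_le_sum (f := fun n => T / p n)
          (fun n _ => div_nonneg hT (hp.nonneg n)) (Finset.mem_Ioc.2 ⟨hn, hnN⟩)
        have h3 : c ≤ C := by rw [hC]; exact le_add_of_nonneg_right (by positivity)
        rw [div_le_iff₀ hpn] at h2
        exact h2.trans (by gcongr)
  · obtain ⟨h1, h2, h3⟩ := hN n hnN.le
    rw [div_lt_iff₀ hpn] at h2 h3
    have hterm : ∀ i, ENNReal.ofReal (θ * p (n - i)) * V i ≤
        ENNReal.ofReal (θ * (C₁ * p n)) * V i +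
          ENNReal.ofReal (θ * C * ((Set.Ioi M).indicator p i * p (n - i))) := by
      intro i
      rcases le_or_gt i M with hi | hi
      · refine le_add_right ?_
        gcongr
        exact h1 i hi
      · refine le_add_left ?_
        calc ENNReal.ofReal (θ * p (n - i)) * V i
            ≤ ENNReal.ofReal (θ * p (n - i)) * ENNReal.ofReal (C * p i) := by
              gcongr; exact hV2 i hi
          _ = _ := by
            rw [← ENNReal.ofReal_mul (mul_nonneg hθ.le (hp.nonneg _)),
              Set.indicator_of_mem (Set.mem_Ioi.2 hi)]
            congr 1; ring
    have hnn : ∀ i, 0 ≤ θ * C * ((Set.Ioi M).indicator p i * p (n - i)) := fun i =>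
      mul_nonneg (by positivity)
        (mul_nonneg (Set.indicator_nonneg (fun i _ => hp.nonneg i) i) (hp.nonneg _))
    calc renewalStep p θ b V n
        ≤ ∑' i, (ENNReal.ofReal (θ * (C₁ * p n)) * V i +
          ENNReal.ofReal (θ * C * ((Set.Ioi M).indicator p i * p (n - i)))) +
          ENNReal.ofReal (p n) := by
          unfold renewalStep
          gcongr
          · exact hterm _
          · linarith
      _ = ENNReal.ofReal (θ * (C₁ * p n)) * ∑' i, V i +
          ENNReal.ofReal (θ * C * ∑' i, ((Set.Ioi M).indicator p i * p (n - i))) +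
          ENNReal.ofReal (p n) := by
          rw [ENNReal.tsum_add, ENNReal.tsum_mul_left, ← ENNReal.ofReal_tsum_of_nonneg hnn
            ((hp.summable_mul_shift (hs.indicator _) n).mul_left _), tsum_mul_left]
      _ ≤ ENNReal.ofReal (θ * (C₁ * p n)) * ENNReal.ofReal T +
          ENNReal.ofReal (θ * C * (r * p n)) + ENNReal.ofReal (p n) := by
          gcongr
      _ = ENNReal.ofReal (θ * (C₁ * p n) * T + θ * C * (r * p n) + p n) := by
          rw [← ENNReal.ofReal_mul (by positivity), ← ENNReal.ofReal_add (by positivity)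
            (by positivity), ← ENNReal.ofReal_add (by positivity) (by positivity)]
      _ ≤ ENNReal.ofReal (C * p n) := by
          apply ENNReal.ofReal_le_ofReal
          have h4 : θ * (C₁ * T) + 1 ≤ C * (1 - θ * r) := by
            rw [hC, add_mul, div_mul_cancel₀ _ h1r.ne']
            exact le_add_of_nonneg_left (by positivity)
          nlinarith

/-- Subsolutions of the renewal equation that are negligible against a superharmonic function
are summable and of order `p n`. -/
lemma bound_of_subsolution (hp : LocallySubexponential p) (hθ : 0 < θ) (hθ1 : θ < 1)
    (hb0 : ∀ n, 0 ≤ b n) (hbs : Summable b)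
    (hbp : Tendsto (fun n => b n / p n) atTop (𝓝 0))
    {ψ w : ℤ → ℝ} (hψ0 : ∀ n, 0 ≤ ψ n) (hw0 : ∀ n, 0 ≤ w n)
    (hψ : ∀ n, ENNReal.ofReal (ψ n) ≤ renewalStep p θ b (fun i => ENNReal.ofReal (ψ i)) n)
    (hw : ∀ n, ∑' i, ENNReal.ofReal (θ * p (n - i)) * ENNReal.ofReal (w i) ≤
      ENNReal.ofReal (w n))
    (hψw : ∀ ε > 0, ∃ c, ∀ n, ψ n ≤ c + ε * w n) :
    Summable ψ ∧ ∃ C : ℝ, ∃ M : ℤ, ∀ n, M < n → ψ n ≤ C * p n := by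
  obtain ⟨C, M, hCM⟩ := hp.exists_invariant_bound hθ hθ1 hb0 hbs hbp
  set T := (∑' n, b n) / (1 - θ) with hTdef
  have hT : 0 ≤ T := div_nonneg (tsum_nonneg hb0) (by linarith)
  set I : Set (ℤ → ℝ≥0∞) := {V | ∑' n, V n ≤ ENNReal.ofReal T ∧
    ∀ n, M < n → V n ≤ ENNReal.ofReal (C * p n)} with hI
  have hIstep : ∀ V ∈ I, renewalStep p θ b V ∈ I := fun V hV =>
    ⟨hp.tsum_renewalStep_le hθ.le hθ1 hb0 hbs hV.1, hCM V hV.1 hV.2⟩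
  have hiter : ∀ ε > 0, ∃ c, 0 ≤ c ∧ ∀ m : ℕ, ∃ V ∈ I, ∀ n, ENNReal.ofReal (ψ n) ≤
      V n + (ENNReal.ofReal (c * θ ^ m) + ENNReal.ofReal (ε * w n)) := by
    intro ε hε
    obtain ⟨c, hc⟩ := hψw ε hε
    refine ⟨|c|, abs_nonneg c, fun m => ?_⟩
    induction m with
    | zero =>
      refine ⟨0, by simp [hI], fun n => ?_⟩
      have := hw0 n
      rw [Pi.zero_apply, zero_add, ← ENNReal.ofReal_add (by positivity) (by positivity)]
      apply ENNReal.ofReal_le_ofReal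
      rw [pow_zero, mul_one]
      linarith [hc n, le_abs_self c]
    | succ m ih =>
      obtain ⟨V, hV, hVψ⟩ := ih
      refine ⟨_, hIstep V hV, fun n => (hψ n).trans ?_⟩
      unfold renewalStep
      calc _ ≤ ∑' i, ENNReal.ofReal (θ * p (n - i)) *
            (V i + (ENNReal.ofReal (|c| * θ ^ m) + ENNReal.ofReal (ε * w i))) +
            ENNReal.ofReal (b n) := by
            gcongr; exact hVψ _
        _ = (∑' i, ENNReal.ofReal (θ * p (n - i)) * V i + ENNReal.ofReal (b n)) +
            (ENNReal.ofReal θ * ENNReal.ofReal (|c| * θ ^ m) + ENNReal.ofReal ε *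
              ∑' i, ENNReal.ofReal (θ * p (n - i)) * ENNReal.ofReal (w i)) := by
            simp_rw [mul_add]
            rw [ENNReal.tsum_add, ENNReal.tsum_add, ENNReal.tsum_mul_right,
              hp.tsum_ofReal_reflect hθ.le, ← ENNReal.tsum_mul_left]
            simp_rw [ENNReal.ofReal_mul hε.le, mul_left_comm (ENNReal.ofReal ε)]
            ring
        _ ≤ (∑' i, ENNReal.ofReal (θ * p (n - i)) * V i + ENNReal.ofReal (b n)) +
            (ENNReal.ofReal θ * ENNReal.ofReal (|c| * θ ^ m) + ENNReal.ofReal ε *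
              ENNReal.ofReal (w n)) := by
            gcongr; exact hw n
        _ = _ := by
            rw [← ENNReal.ofReal_mul hθ.le, ← ENNReal.ofReal_mul hε.le]
            congr 3; ring
  have happrox : ∀ (S : Finset ℤ) (ε : NNReal), 0 < ε → ∃ V ∈ I,
      ∑ n ∈ S, ENNReal.ofReal (ψ n) ≤ ∑ n ∈ S, V n + ε := by
    intro S ε hε
    have hε' : (0 : ℝ) < ε := hε
    have hW : 0 ≤ ∑ n ∈ S, w n := Finset.sum_nonneg fun n _ => hw0 n
    obtain ⟨c, hc0, hc⟩ := hiter (ε / 2 / (∑ n ∈ S, w n + 1)) (by positivity)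
    have hlim : Tendsto (fun m : ℕ => (S.card : ℝ) * (c * θ ^ m)) atTop (𝓝 0) := by
      simpa using ((tendsto_pow_atTop_nhds_zero_of_lt_one hθ.le hθ1).const_mul c).const_mul
        (S.card : ℝ)
    obtain ⟨m, hm⟩ := (hlim.eventually_lt_const (half_pos hε')).exists
    obtain ⟨V, hV, hVψ⟩ := hc m
    refine ⟨V, hV, (Finset.sum_le_sum fun n _ => hVψ n).trans ?_⟩
    rw [Finset.sum_add_distrib]
    gcongr
    have hnn : ∀ n, 0 ≤ ε / 2 / (∑ n ∈ S, w n + 1) * w n := fun n =>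
      mul_nonneg (by positivity) (hw0 n)
    rw [Finset.sum_add_distrib, Finset.sum_const, ← ENNReal.ofReal_sum_of_nonneg (fun n _ => hnn n),
      ← ENNReal.ofReal_nsmul, ← ENNReal.ofReal_add (by positivity)
        (Finset.sum_nonneg fun n _ => hnn n), ← Finset.mul_sum]
    conv_rhs => rw [← ENNReal.ofReal_coe_nnreal]
    apply ENNReal.ofReal_le_ofReal
    rw [nsmul_eq_mul]
    have : ε / 2 / (∑ n ∈ S, w n + 1) * ∑ n ∈ S, w n ≤ ε / 2 := by
      rw [div_mul_eq_mul_div, div_le_iff₀ (by positivity)]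
      nlinarith
    linarith
  constructor
  · refine summable_of_sum_le hψ0 (c := T) fun S => ?_
    rw [← ENNReal.ofReal_le_ofReal_iff hT, ENNReal.ofReal_sum_of_nonneg fun n _ => hψ0 n]
    refine ENNReal.le_of_forall_pos_le_add fun ε hε _ => ?_
    obtain ⟨V, hV, h1⟩ := happrox S ε hε
    refine h1.trans ?_
    gcongr
    exact (ENNReal.sum_le_tsum S).trans hV.1
  · refine ⟨|C|, M, fun n hn => ?_⟩
    rw [← ENNReal.ofReal_le_ofReal_iff (mul_nonneg (abs_nonneg C) (hp.nonneg n))]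
    refine ENNReal.le_of_forall_pos_le_add fun ε hε _ => ?_
    obtain ⟨V, hV, h1⟩ := happrox {n} ε hε
    simp only [Finset.sum_singleton] at h1
    refine h1.trans ?_
    gcongr
    refine (hV.2 n hn).trans (ENNReal.ofReal_le_ofReal ?_)
    gcongr
    exacts [hp.nonneg n, le_abs_self C]

end LocallySubexponential

namespace LocallySubexponential

variable {p : ℤ → ℝ}

/-- Upper bound for the error in one step of the limit argument. -/
lemma abs_conv_sub_le (hp : LocallySubexponential p) {ψ : ℤ → ℝ} (hψ0 : ∀ n, 0 ≤ ψ n)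
    (hψs : Summable ψ) {C L D : ℝ} (hL : 0 ≤ L) {M n : ℤ} (hn : 2 * M < n)
    (hpn : 0 < p n) (hψp : ∀ i, M < i → ψ i ≤ C * p i)
    (hD : ∀ i, n - M ≤ i → |ψ i - L * p i| ≤ D * p i) :
    |(∑' i, ψ i * p (n - i)) / p n - (∑' i, ψ i + L)| ≤
      |(∑' i, (Set.Iic M).indicator ψ i * p (n - i)) / p n - ∑' i, ψ i| +
      (D * ((∑' i, (Set.Iic M).indicator p i * p (n - i)) / p n) +
        L * |(∑' i, (Set.Iic M).indicator p i * p (n - i)) / p n - 1|) +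
      C * ((∑' i, p i * p (n - i)) / p n -
        2 * ((∑' i, (Set.Iic M).indicator p i * p (n - i)) / p n)) := by
  have hs := hp.hasSum_one.summable
  -- reflected summability and sums
  have hrefl : ∀ F : ℤ → ℝ, ∑' i, F (n - i) = ∑' i, F i := fun F => (Equiv.subLeft n).tsum_eq F
  have hsrefl : ∀ F : ℤ → ℝ, Summable F → Summable fun i => F (n - i) := fun F hF =>
    (Equiv.subLeft n).summable_iff.2 hF
  have hsA := hp.summable_mul_shift hψs n
  have hsA1 := hp.summable_mul_shift (hψs.indicator (Set.Iic M)) n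
  have hsP := hp.summable_mul_shift hs n
  have hsP1 := hp.summable_mul_shift (hs.indicator (Set.Iic M)) n
  have hψb : ∀ i, ψ i ≤ ∑' i, ψ i := fun i => hψs.le_tsum i fun j _ => hψ0 j
  have hsB : Summable fun i => (Set.Iic M).indicator p i * ψ (n - i) := by
    refine Summable.of_norm_bounded ((hs.indicator (Set.Iic M)).norm.mul_right (∑' i, ψ i))
      fun i => ?_
    rw [norm_mul, Real.norm_of_nonneg (hψ0 _)]
    gcongr
    exact hψb _
  have hsBr : Summable fun i => (Set.Iic M).indicator p (n - i) * ψ i := by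
    simpa using hsrefl _ hsB
  have hsP1r : Summable fun i => (Set.Iic M).indicator p (n - i) * p i := by
    simpa using hsrefl _ hsP1
  have hBr : ∑' i, (Set.Iic M).indicator p (n - i) * ψ i =
      ∑' i, (Set.Iic M).indicator p i * ψ (n - i) := by
    simpa using hrefl fun i => (Set.Iic M).indicator p i * ψ (n - i)
  have hP1r : ∑' i, (Set.Iic M).indicator p (n - i) * p i =
      ∑' i, (Set.Iic M).indicator p i * p (n - i) := by
    simpa using hrefl fun i => (Set.Iic M).indicator p i * p (n - i)
  -- the remainder
  have hrem : ∀ i, |ψ i * p (n - i) - (Set.Iic M).indicator ψ i * p (n - i) -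
      (Set.Iic M).indicator p (n - i) * ψ i| ≤
      C * (p i * p (n - i) - (Set.Iic M).indicator p i * p (n - i) -
        (Set.Iic M).indicator p (n - i) * p i) := by
    intro i
    by_cases h1 : i ≤ M
    · have h2 : ¬ n - i ≤ M := by omega
      simp [h1, h2]
    · by_cases h2 : n - i ≤ M
      · simp [h1, h2, mul_comm]
      · simp only [Set.mem_Iic, h1, h2, not_false_eq_true, Set.indicator_of_notMem, zero_mul,
          sub_zero]
        rw [abs_of_nonneg (mul_nonneg (hψ0 _) (hp.nonneg _)), ← mul_assoc]
        gcongr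
        · exact hp.nonneg _
        · exact hψp i (not_le.1 h1)
  have hremsum : |∑' i, ψ i * p (n - i) - ∑' i, (Set.Iic M).indicator ψ i * p (n - i) -
      ∑' i, (Set.Iic M).indicator p i * ψ (n - i)| ≤
      C * (∑' i, p i * p (n - i) - 2 * ∑' i, (Set.Iic M).indicator p i * p (n - i)) := by
    have h1 := (((hsP.sub hsP1).sub hsP1r).mul_left C).hasSum
    have h3 := tsum_of_norm_bounded (f := fun i => ψ i * p (n - i) -
      (Set.Iic M).indicator ψ i * p (n - i) - (Set.Iic M).indicator p (n - i) * ψ i) h1 hrem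
    rw [(hsA.sub hsA1).tsum_sub hsBr, hsA.tsum_sub hsA1, tsum_mul_left,
      (hsP.sub hsP1).tsum_sub hsP1r, hsP.tsum_sub hsP1, hBr, hP1r, Real.norm_eq_abs] at h3
    refine h3.trans_eq ?_
    ring
  have hmid : |∑' i, (Set.Iic M).indicator p i * ψ (n - i) -
      L * ∑' i, (Set.Iic M).indicator p i * p (n - i)| ≤
      D * ∑' i, (Set.Iic M).indicator p i * p (n - i) := by
    have h3 : ∀ i, ‖(Set.Iic M).indicator p i * ψ (n - i) -
        L * ((Set.Iic M).indicator p i * p (n - i))‖ ≤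
        D * ((Set.Iic M).indicator p i * p (n - i)) := by
      intro i
      by_cases h1 : i ≤ M
      · simp only [Set.mem_Iic, h1, Set.indicator_of_mem]
        rw [mul_left_comm L, ← mul_sub, norm_mul, Real.norm_of_nonneg (hp.nonneg _),
          mul_left_comm D]
        gcongr
        · exact hp.nonneg _
        · exact hD _ (by omega)
      · simp [h1]
    have h4 := tsum_of_norm_bounded (hsP1.mul_left D).hasSum h3
    rwa [hsB.tsum_sub (hsP1.mul_left L), tsum_mul_left, tsum_mul_left, Real.norm_eq_abs] at h4
  set a := ∑' i, ψ i * p (n - i)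
  set a₁ := ∑' i, (Set.Iic M).indicator ψ i * p (n - i)
  set a₂ := ∑' i, (Set.Iic M).indicator p i * ψ (n - i)
  set e := ∑' i, (Set.Iic M).indicator p i * p (n - i)
  set f := ∑' i, p i * p (n - i)
  have hdiv : ∀ x y : ℝ, |x| ≤ y → |x / p n| ≤ y / p n := fun x y hxy => by
    rw [abs_div, abs_of_pos hpn]; gcongr
  have k1 := hdiv _ _ hremsum
  have k2 := hdiv _ _ hmid
  have k3 : a / p n - (∑' i, ψ i + L) = (a - a₁ - a₂) / p n + (a₁ / p n - ∑' i, ψ i) +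
      ((a₂ - L * e) / p n + L * (e / p n - 1)) := by
    field_simp
    ring
  rw [k3]
  have k4 : |L * (e / p n - 1)| = L * |e / p n - 1| := by rw [abs_mul, abs_of_nonneg hL]
  have k5 : D * e / p n = D * (e / p n) := by ring
  have k6 : C * (f - 2 * e) / p n = C * (f / p n - 2 * (e / p n)) := by ring
  calc _ ≤ (|(a - a₁ - a₂) / p n| + |a₁ / p n - ∑' i, ψ i|) +
      (|(a₂ - L * e) / p n| + |L * (e / p n - 1)|) :=
        (abs_add_le _ _).trans (add_le_add (abs_add_le _ _) (abs_add_le _ _))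
    _ ≤ _ := by linarith

/-- Summable solutions of order `O(p n)` of the renewal equation `ψ = θ p * ψ + g`. -/
lemma tendsto_of_renewal (hp : LocallySubexponential p) {θ : ℝ} (hθ : 0 < θ) (hθ1 : θ < 1)
    {ψ g : ℤ → ℝ} (hψ0 : ∀ n, 0 ≤ ψ n) (hψs : Summable ψ)
    (hψp : ∃ C : ℝ, ∃ M : ℤ, ∀ n, M < n → ψ n ≤ C * p n)
    (hgp : Tendsto (fun n => g n / p n) atTop (𝓝 0))
    (hψ : ∀ n, ψ n = θ * ∑' i, ψ i * p (n - i) + g n) :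
    Tendsto (fun n => ψ n / p n) atTop (𝓝 (θ / (1 - θ) * ∑' i, ψ i)) := by
  have hs := hp.hasSum_one.summable
  have h1θ : 0 < 1 - θ := by linarith
  set S := ∑' i, ψ i with hS
  have hS0 : 0 ≤ S := tsum_nonneg hψ0
  set L := θ / (1 - θ) * S with hL
  have hL0 : 0 ≤ L := by positivity
  have hLeq : θ * (S + L) = L := by rw [hL]; field_simp; ring
  obtain ⟨C, M₀, hM₀⟩ := hψp
  have hstep : ∀ D : ℝ, (∀ᶠ n in atTop, |ψ n - L * p n| ≤ D * p n) → ∀ η > 0,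
      ∀ᶠ n in atTop, |ψ n - L * p n| ≤ (θ * D + η) * p n := by
    intro D hD η hη
    have hlimM : Tendsto (fun M : ℤ =>
        θ * (|∑' i, (Set.Iic M).indicator ψ i - S| +
          (D * ∑' i, (Set.Iic M).indicator p i + L * |∑' i, (Set.Iic M).indicator p i - 1|) +
          C * (2 - 2 * ∑' i, (Set.Iic M).indicator p i)) + 0) atTop (𝓝 (θ * D)) := by
      have h1 := tendsto_partial hψs
      have h2 := tendsto_partial hs
      rw [hp.hasSum_one.tsum_eq] at h2
      have := ((((h1.sub_const S).abs.add ((h2.const_mul D).add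
        ((h2.sub_const 1).abs.const_mul L))).add
        (((h2.const_mul 2).const_sub 2).const_mul C)).const_mul θ).add_const 0
      simpa [← hS] using this
    obtain ⟨M, hM1, hM2⟩ := ((hlimM.eventually_lt_const (lt_add_of_pos_right _ hη)).and
      (eventually_ge_atTop M₀)).exists
    have h1 := hp.tendsto_conv_left hψs M
    have h2 := hp.tendsto_conv_left hs M
    have hlim := (((((h1.sub_const S).abs.add ((h2.const_mul D).add
        ((h2.sub_const 1).abs.const_mul L))).add
        ((hp.conv.sub (h2.const_mul 2)).const_mul C)).const_mul θ)).add hgp.abs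
    rw [abs_zero] at hlim
    obtain ⟨N, hN⟩ := eventually_atTop.1 hD
    filter_upwards [hlim.eventually_lt_const hM1, hp.eventually_pos, eventually_gt_atTop (2 * M),
      eventually_ge_atTop (N + M)] with n k1 hpn k2 k3
    have key := hp.abs_conv_sub_le hψ0 hψs hL0 k2 hpn
      (fun i hi => hM₀ i (by omega)) (fun i hi => hN i (by omega))
    have e1 : ψ n - L * p n = (θ * ((∑' i, ψ i * p (n - i)) / p n - (S + L)) + g n / p n) * p n := by
      rw [hψ n, mul_sub, hLeq]
      field_simp
      ring
    rw [e1, abs_mul, abs_of_pos hpn]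
    gcongr
    refine (abs_add_le _ _).trans (le_trans ?_ k1.le)
    rw [abs_mul, abs_of_pos hθ]
    gcongr
  obtain ⟨D, hD⟩ : ∃ D : ℝ, ∀ᶠ n in atTop, |ψ n - L * p n| ≤ D * p n := by
    refine ⟨C + L, ?_⟩
    filter_upwards [eventually_gt_atTop M₀] with n hn
    refine (abs_sub _ _).trans ?_
    rw [abs_of_nonneg (hψ0 n), abs_of_nonneg (mul_nonneg hL0 (hp.nonneg n)), add_mul]
    gcongr
    exact hM₀ n hn
  have hiter : ∀ η > 0, ∀ m : ℕ,
      ∀ᶠ n in atTop, |ψ n - L * p n| ≤ (θ ^ m * D + η / (1 - θ)) * p n := by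
    intro η hη m
    induction m with
    | zero =>
      filter_upwards [hD] with n hn
      refine hn.trans ?_
      have := hp.nonneg n
      gcongr
      rw [pow_zero, one_mul]
      exact le_add_of_nonneg_right (by positivity)
    | succ m ih =>
      filter_upwards [hstep _ ih η hη] with n hn
      refine hn.trans_eq ?_
      field_simp
      ring
  rw [Metric.tendsto_nhds]
  intro ε hε
  have hlim : Tendsto (fun m : ℕ => θ ^ m * D + (ε / 2 * (1 - θ)) / (1 - θ)) atTop
      (𝓝 (ε / 2)) := by
    have := ((tendsto_pow_atTop_nhds_zero_of_lt_one hθ.le hθ1).mul_const D).add_const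
      ((ε / 2 * (1 - θ)) / (1 - θ))
    rw [zero_mul, zero_add, mul_div_cancel_right₀ _ h1θ.ne'] at this
    rwa [mul_div_cancel_right₀ _ h1θ.ne']
  obtain ⟨m, hm⟩ := (hlim.eventually_lt_const (half_lt_self hε)).exists
  filter_upwards [hiter (ε / 2 * (1 - θ)) (by positivity) m, hp.eventually_pos] with n h1 hpn
  rw [Real.dist_eq]
  have e1 : ψ n / p n - L = (ψ n - L * p n) / p n := by field_simp
  rw [e1, abs_div, abs_of_pos hpn, div_lt_iff₀ hpn]
  exact h1.trans_lt (by gcongr)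

/-- The renewal theorem for locally subexponential sequences. -/
theorem renewal (hp : LocallySubexponential p) {θ : ℝ} (hθ : 0 < θ) (hθ1 : θ < 1)
    {ψ g w : ℤ → ℝ} (hg0 : ∀ n, 0 ≤ g n) (hgs : Summable g)
    (hgp : Tendsto (fun n => g n / p n) atTop (𝓝 0))
    (hψ0 : ∀ n, 0 ≤ ψ n) (hw0 : ∀ n, 0 ≤ w n)
    (hψ : ∀ n, ENNReal.ofReal (ψ n) = renewalStep p θ g (fun i => ENNReal.ofReal (ψ i)) n)
    (hw : ∀ n, ∑' i, ENNReal.ofReal (θ * p (n - i)) * ENNReal.ofReal (w i) ≤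
      ENNReal.ofReal (w n))
    (hψw : ∀ ε > 0, ∃ c, ∀ n, ψ n ≤ c + ε * w n) :
    Summable ψ ∧ Tendsto (fun n => ψ n / p n) atTop (𝓝 (θ / (1 - θ) * ∑' i, ψ i)) := by
  obtain ⟨h1, h2⟩ := hp.bound_of_subsolution hθ hθ1 hg0 hgs hgp hψ0 hw0 (fun n => (hψ n).le) hw hψw
  refine ⟨h1, hp.tendsto_of_renewal hθ hθ1 hψ0 h1 h2 hgp fun n => ?_⟩
  have hnn : ∀ i, 0 ≤ θ * (ψ i * p (n - i)) := fun i =>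
    mul_nonneg hθ.le (mul_nonneg (hψ0 i) (hp.nonneg _))
  have h3 : renewalStep p θ g (fun i => ENNReal.ofReal (ψ i)) n =
      ENNReal.ofReal (θ * ∑' i, ψ i * p (n - i) + g n) := by
    unfold renewalStep
    rw [ENNReal.ofReal_add (mul_nonneg hθ.le (tsum_nonneg fun i =>
      mul_nonneg (hψ0 i) (hp.nonneg _))) (hg0 n), ← tsum_mul_left,
      ENNReal.ofReal_tsum_of_nonneg hnn ((hp.summable_mul_shift h1 n).mul_left θ)]
    congr 2 with i
    rw [← ENNReal.ofReal_mul (mul_nonneg hθ.le (hp.nonneg _))]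
    congr 1; ring
  have h4 := (hψ n).trans h3
  rwa [ENNReal.ofReal_eq_ofReal_iff (hψ0 n)] at h4
  exact add_nonneg (mul_nonneg hθ.le (tsum_nonneg fun i =>
      mul_nonneg (hψ0 i) (hp.nonneg _))) (hg0 n)

end LocallySubexponential

lemma LocallySubexponential.tendsto_exp_div {p : ℤ → ℝ} (hp : LocallySubexponential p) {d : ℝ}
    (hd : 0 < d) : Tendsto (fun n : ℤ => Real.exp (-d * n) / p n) atTop (𝓝 0) := by
  rw [← Nat.map_cast_int_atTop, tendsto_map'_iff]
  refine Summable.tendsto_atTop_zero ?_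
  have hcast : Tendsto (fun n : ℕ => (n : ℤ)) atTop atTop := tendsto_natCast_atTop_atTop
  have hpos := hcast.eventually (eventually_forall_ge_atTop.2 hp.eventually_pos)
  refine summable_of_ratio_test_tendsto_lt_one (Real.exp_lt_one_iff.2 (neg_lt_zero.2 hd)) ?_ ?_
  · filter_upwards [hpos] with n hn
    exact div_ne_zero (Real.exp_pos _).ne' (hn n le_rfl).ne'
  · have h1 := ((hp.ratio.comp hcast).inv₀ one_ne_zero).const_mul (Real.exp (-d))
    rw [inv_one, mul_one] at h1
    refine h1.congr' ?_
    filter_upwards [hpos] with n hn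
    have k1 := hn n le_rfl
    have k2 := hn (n + 1) (by omega)
    simp only [Function.comp]
    rw [Real.norm_of_nonneg (by push_cast; positivity), Real.norm_of_nonneg (by positivity)]
    have : Real.exp (-d * ((n + 1 : ℕ) : ℤ)) = Real.exp (-d) * Real.exp (-d * (n : ℤ)) := by
      rw [← Real.exp_add]; push_cast; congr 1; ring
    rw [this]
    push_cast
    have := Real.exp_pos (-d * n)
    field_simp

section Lattice

variable {h : ℝ}

lemma lintegral_lattice (hh : 0 < h) {μ : Measure ℝ}
    (hμ : μ (Set.range fun k : ℤ => (k : ℝ) * h)ᶜ = 0) (f : ℝ → ℝ≥0∞) :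
    ∫⁻ x, f x ∂μ = ∑' k : ℤ, f (k * h) * μ {(k : ℝ) * h} := by
  have hinj : Function.Injective fun k : ℤ => (k : ℝ) * h := fun a b hab => by
    simpa [hh.ne'] using hab
  rw [← setLIntegral_univ, ← setLIntegral_congr (ae_eq_univ.2 hμ),
    lintegral_countable _ (Set.countable_range _),
    tsum_range (fun x => f x * μ {x}) hinj]

lemma measure_lattice (hh : 0 < h) {μ : Measure ℝ}
    (hμ : μ (Set.range fun k : ℤ => (k : ℝ) * h)ᶜ = 0) :
    ∑' k : ℤ, μ {(k : ℝ) * h} = μ Set.univ := by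
  simpa using (lintegral_lattice hh hμ fun _ => 1).symm

lemma mconv_lattice (hh : 0 < h) {μ : Measure ℝ} [SFinite μ]
    (hμ : μ (Set.range fun k : ℤ => (k : ℝ) * h)ᶜ = 0) (n : ℤ) :
    mconv μ μ {(n : ℝ) * h} = ∑' i : ℤ, μ {(i : ℝ) * h} * μ {((n - i : ℤ) : ℝ) * h} := by
  have hm : Measurable fun p : ℝ × ℝ => p.1 + p.2 := measurable_fst.add measurable_snd
  rw [mconv, Measure.map_apply hm (measurableSet_singleton _),
    Measure.prod_apply (hm (measurableSet_singleton _)), lintegral_lattice hh hμ]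
  congr 1 with i
  rw [mul_comm]
  congr 2
  ext y
  simp only [Set.mem_preimage, Set.mem_singleton_iff]
  push_cast
  constructor <;> intro hy <;> linarith

end Lattice

lemma toReal_Iic_sub_Iio (μ : Measure ℝ) [IsFiniteMeasure μ] (a : ℝ) :
    (μ (Set.Iic a)).toReal - (μ (Set.Iio a)).toReal = (μ {a}).toReal := by
  have h1 : μ (Set.Iic a) = μ (Set.Iio a) + μ {a} := by
    rw [← Set.Iio_union_right, measure_union (by simp) (measurableSet_singleton a)]
  rw [h1, ENNReal.toReal_add (measure_ne_top _ _) (measure_ne_top _ _), add_sub_cancel_left]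

section Tilted

variable {Ω : Type*} [MeasurableSpace Ω] {P : Measure Ω} {A : Ω → ℝ} {κ θ h : ℝ}

lemma ae_lattice (hlat : P {ω | A ω ≠ 0 ∧ ∀ k : ℤ, Real.log (A ω) ≠ (k : ℝ) * h} = 0) :
    ∀ᵐ ω ∂P, A ω = 0 ∨ ∃ k : ℤ, Real.log (A ω) = k * h := by
  rw [ae_iff]
  simpa [not_or] using hlat

lemma normTilted_compl_lattice (hA : Measurable A)
    (hlat : P {ω | A ω ≠ 0 ∧ ∀ k : ℤ, Real.log (A ω) ≠ (k : ℝ) * h} = 0) :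
    normTilted P A κ θ (Set.range fun k : ℤ => (k : ℝ) * h)ᶜ = 0 := by
  have hm : MeasurableSet (Set.range fun k : ℤ => (k : ℝ) * h)ᶜ :=
    (Set.countable_range _).measurableSet.compl
  have hlog : Measurable fun ω => Real.log (A ω) := Real.measurable_log.comp hA
  rw [normTilted, Measure.smul_apply, tiltedLog, Measure.map_apply hlog hm]
  have h1 : P ((fun ω => Real.log (A ω)) ⁻¹' (Set.range fun k : ℤ => (k : ℝ) * h)ᶜ) = 0 := by
    refine measure_mono_null (fun ω hω => ?_) hlat
    simp only [Set.mem_preimage, Set.mem_compl_iff, Set.mem_range, not_exists] at hω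
    exact ⟨fun h0 => hω 0 (by simp [h0]), fun k hk => hω k hk.symm⟩
  rw [withDensity_absolutelyContinuous P _ h1, smul_zero]

lemma normTilted_singleton (hA : Measurable A) (hA0 : ∀ᵐ ω ∂P, 0 ≤ A ω) (hκ : 0 < κ) (k : ℤ) :
    normTilted P A κ θ {(k : ℝ) * h} = (ENNReal.ofReal θ)⁻¹ *
      (ENNReal.ofReal (Real.exp (κ * (k * h))) * P {ω | A ω = Real.exp (k * h)}) := by
  have hlog : Measurable fun ω => Real.log (A ω) := Real.measurable_log.comp hA
  have hS := hlog (measurableSet_singleton ((k : ℝ) * h))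
  have hS' : MeasurableSet {ω | A ω = Real.exp (k * h)} := hA (measurableSet_singleton _)
  rw [normTilted, Measure.smul_apply, tiltedLog, Measure.map_apply hlog (measurableSet_singleton _),
    withDensity_apply _ hS, smul_eq_mul, ← lintegral_indicator hS, ← setLIntegral_const,
    ← lintegral_indicator hS']
  congr 1
  classical
  refine lintegral_congr_ae ?_
  filter_upwards [hA0] with ω hω
  rcases hω.eq_or_lt with h0 | h0
  · have : ω ∉ {ω | A ω = Real.exp (k * h)} := by simp [← h0, (Real.exp_pos _).ne]
    rw [Set.indicator_of_notMem this, Set.indicator_apply, ← h0, Real.zero_rpow hκ.ne']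
    simp
  · have hiff : ω ∈ (fun ω => Real.log (A ω)) ⁻¹' {(k : ℝ) * h} ↔
        ω ∈ {ω | A ω = Real.exp (k * h)} := by
      simp only [Set.mem_preimage, Set.mem_singleton_iff, Set.mem_ofPred_eq]
      exact ⟨fun hk => by rw [← hk, Real.exp_log h0], fun hk => by rw [hk, Real.log_exp]⟩
    by_cases hk : ω ∈ {ω | A ω = Real.exp (k * h)}
    · rw [Set.indicator_of_mem hk, Set.indicator_of_mem (hiff.2 hk), hk, ← Real.exp_mul, mul_comm κ]
    · rw [Set.indicator_of_notMem hk, Set.indicator_of_notMem (mt hiff.1 hk)]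

lemma isProbabilityMeasure_normTilted (hA : Measurable A) (hA0 : ∀ᵐ ω ∂P, 0 ≤ A ω) (hθ : 0 < θ)
    (hint : ∫ ω, A ω ^ κ ∂P = θ) : IsProbabilityMeasure (normTilted P A κ θ) := by
  constructor
  have hi : Integrable (fun ω => A ω ^ κ) P := by
    by_contra hc
    rw [integral_undef hc] at hint
    exact hθ.ne hint
  have hlog : Measurable fun ω => Real.log (A ω) := Real.measurable_log.comp hA
  rw [normTilted, Measure.smul_apply, tiltedLog, Measure.map_apply hlog MeasurableSet.univ, Set.preimage_univ, withDensity_apply _ MeasurableSet.univ,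
    setLIntegral_univ, ← ofReal_integral_eq_lintegral_ofReal hi
      (hA0.mono fun ω hω => Real.rpow_nonneg hω κ), hint, smul_eq_mul,
    ENNReal.inv_mul_cancel (by simpa using hθ) ENNReal.ofReal_ne_top]

lemma pA3_eq [IsFiniteMeasure (normTilted P A κ θ)] (k : ℤ) :
    pA3 P A κ θ h k = (normTilted P A κ θ {(k : ℝ) * h}).toReal :=
  toReal_Iic_sub_Iio _ _

lemma ofReal_mul_pA3 (hA : Measurable A) (hA3 : AssumptionA3 P A κ θ h) (k : ℤ) :
    ENNReal.ofReal (θ * pA3 P A κ θ h k) =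
      ENNReal.ofReal (Real.exp (κ * (k * h))) * P {ω | A ω = Real.exp (k * h)} := by
  obtain ⟨hκ, hθ, -, hA0, hint, -⟩ := hA3
  have := isProbabilityMeasure_normTilted hA hA0 hθ hint
  rw [pA3_eq, ENNReal.ofReal_mul hθ.le, ENNReal.ofReal_toReal (measure_ne_top _ _),
    normTilted_singleton hA hA0 hκ, ← mul_assoc,
    ENNReal.mul_inv_cancel (by simpa using hθ) ENNReal.ofReal_ne_top, one_mul]

lemma AssumptionA3.locallySubexponential (hA : Measurable A) (hA3 : AssumptionA3 P A κ θ h) :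
    LocallySubexponential (pA3 P A κ θ h) := by
  obtain ⟨hκ, hθ, hθ1, hA0, hint, ⟨hh, hlat, -⟩, hratio, hconv, C, hC⟩ := hA3
  have := isProbabilityMeasure_normTilted hA hA0 hθ hint
  have hμ := normTilted_compl_lattice (κ := κ) (θ := θ) hA hlat
  have hsum := measure_lattice hh hμ
  rw [measure_univ] at hsum
  refine ⟨fun n => ?_, ?_, ?_, ?_, C, ?_⟩
  · rw [pA3_eq]; exact ENNReal.toReal_nonneg
  · have h1 := ENNReal.hasSum_toReal (hsum ▸ ENNReal.one_ne_top)
    rw [← ENNReal.tsum_toReal_eq fun _ => measure_ne_top _ _, hsum, ENNReal.toReal_one] at h1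
    rwa [← funext fun k : ℤ => pA3_eq (P := P) (A := A) (κ := κ) (θ := θ) (h := h) k] at h1
  · rw [← Nat.map_cast_int_atTop, tendsto_map'_iff]
    exact hratio
  · rw [← Nat.map_cast_int_atTop, tendsto_map'_iff]
    refine hconv.congr fun n => ?_
    have : IsFiniteMeasure (mconv (normTilted P A κ θ) (normTilted P A κ θ)) := by
      unfold mconv; infer_instance
    simp only [Function.comp]
    rw [p2A3, toReal_Iic_sub_Iio, mconv_lattice hh hμ,
      ENNReal.tsum_toReal_eq fun _ => ENNReal.mul_ne_top (measure_ne_top _ _) (measure_ne_top _ _)]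
    simp_rw [ENNReal.toReal_mul, pA3_eq]
  · rw [← Nat.map_cast_int_atTop, eventually_map]
    filter_upwards [hC] with n hn k hk
    lift k to ℕ using by omega
    exact hn k (by exact_mod_cast hk)

end Tilted

section MaximumEquation

variable {Ω : Type*} [MeasurableSpace Ω] {P : Measure Ω}
  {A B X : Ω → ℝ} {κ θ h : ℝ}

lemma tail_maximum_eq (hA : Measurable A) (hB : Measurable B) (hX : Measurable X)
    (hA0 : ∀ᵐ ω ∂P, 0 ≤ A ω) (hh : 0 < h)
    (hlat : P {ω | A ω ≠ 0 ∧ ∀ k : ℤ, Real.log (A ω) ≠ (k : ℝ) * h} = 0)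
    (hindep : IndepFun (fun ω => (A ω, B ω)) X P)
    (heq : Measure.map X P = Measure.map (fun ω => max (A ω * X ω) (B ω)) P) {t : ℝ}
    (ht : 0 < t) :
    P {ω | X ω > t} = ∑' k : ℤ, P {ω | A ω = Real.exp (k * h)} *
      P {ω | X ω > t * Real.exp (-(k * h))} + P {ω | A ω * X ω ≤ t ∧ B ω > t} := by
  have hAX : Measurable fun ω => A ω * X ω := hA.mul hX
  have h1 : P {ω | X ω > t} = P {ω | max (A ω * X ω) (B ω) > t} := by
    have := congrArg (fun μ => μ (Set.Ioi t)) heq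
    simp only [Measure.map_apply hX measurableSet_Ioi,
      Measure.map_apply (hAX.max hB) measurableSet_Ioi] at this
    exact this
  have h2 : {ω | max (A ω * X ω) (B ω) > t} =
      {ω | A ω * X ω > t} ∪ {ω | A ω * X ω ≤ t ∧ B ω > t} := by
    ext ω
    simp only [gt_iff_lt, lt_max_iff, Set.mem_ofPred_eq, Set.mem_union]
    have := lt_or_ge t (A ω * X ω)
    tauto
  have h3 : MeasurableSet {ω | A ω * X ω ≤ t ∧ B ω > t} :=
    (measurableSet_le hAX measurable_const).inter (measurableSet_lt measurable_const hB)
  rw [h1, h2, measure_union _ h3]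
  swap
  · rw [Set.disjoint_left]
    intro ω h4 h5
    exact absurd h5.1 (not_le.2 h4)
  congr 1
  have h4 : {ω | A ω * X ω > t} =ᵐ[P]
      ⋃ k : ℤ, A ⁻¹' {Real.exp (k * h)} ∩ X ⁻¹' Set.Ioi (t * Real.exp (-(k * h))) := by
    filter_upwards [hA0, ae_lattice hlat] with ω h5 h6
    refine propext ?_
    change A ω * X ω > t ↔
      ω ∈ ⋃ k : ℤ, A ⁻¹' {Real.exp (k * h)} ∩ X ⁻¹' Set.Ioi (t * Real.exp (-(k * h)))
    have key : ∀ k : ℤ, A ω = Real.exp (k * h) →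
        (t < A ω * X ω ↔ t * Real.exp (-(k * h)) < X ω) := fun k hk => by
      rw [hk, Real.exp_neg, ← div_eq_mul_inv, div_lt_iff₀ (Real.exp_pos _), mul_comm (X ω)]
    simp only [gt_iff_lt, Set.mem_iUnion, Set.mem_inter_iff, Set.mem_preimage,
      Set.mem_singleton_iff, Set.mem_Ioi]
    constructor
    · intro h7
      have hne : A ω ≠ 0 := by
        intro h0
        rw [h0, zero_mul] at h7
        exact lt_asymm ht h7
      obtain ⟨k, hk⟩ := h6.resolve_left hne
      have hk' : A ω = Real.exp (k * h) := by
        rw [← hk, Real.exp_log (lt_of_le_of_ne h5 hne.symm)]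
      exact ⟨k, hk', (key k hk').1 h7⟩
    · rintro ⟨k, hk, h7⟩
      exact (key k hk).2 h7
  rw [measure_congr h4, measure_iUnion]
  · congr 1 with k
    exact (hindep.comp measurable_fst measurable_id).measure_inter_preimage_eq_mul _ _
      (measurableSet_singleton _) measurableSet_Ioi
  · intro i j hij
    rw [Function.onFun, Set.disjoint_left]
    rintro ω ⟨h5, -⟩ ⟨h6, -⟩
    refine hij ?_
    have h7 : Real.exp (i * h) = Real.exp (j * h) := by
      rw [← Set.mem_singleton_iff.1 h5, ← Set.mem_singleton_iff.1 h6]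
    simpa [hh.ne'] using h7
  · exact fun k => (hA (measurableSet_singleton _)).inter (hX measurableSet_Ioi)

lemma mul_exp_rpow {x : ℝ} (hx : 0 < x) (n s h : ℝ) :
    (x * Real.exp (n * h)) ^ s = x ^ s * Real.exp (s * h * n) := by
  rw [Real.mul_rpow hx.le (Real.exp_pos _).le, ← Real.exp_mul]
  congr 2; ring

lemma rpow_mul_tail_le (hB : Measurable B) {ν : ℝ} (hν : 0 < ν)
    (hint : ∫⁻ ω, ENNReal.ofReal (|B ω| ^ ν) ∂P < ⊤) {t : ℝ} (ht : 0 < t) :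
    t ^ ν * (P {ω | B ω > t}).toReal ≤ (∫⁻ ω, ENNReal.ofReal (|B ω| ^ ν) ∂P).toReal := by
  have hm : Measurable fun ω => ENNReal.ofReal (|B ω| ^ ν) :=
    (hB.abs.pow_const ν).ennreal_ofReal
  have h1 : ENNReal.ofReal (t ^ ν) * P {ω | B ω > t} ≤ ∫⁻ ω, ENNReal.ofReal (|B ω| ^ ν) ∂P := by
    refine le_trans ?_ (mul_meas_ge_le_lintegral hm (ENNReal.ofReal (t ^ ν)))
    gcongr with ω
    intro hω
    have hω' : t < B ω := hω
    exact ENNReal.ofReal_le_ofReal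
      (Real.rpow_le_rpow ht.le (hω'.le.trans (le_abs_self _)) hν.le)
  have h2 := ENNReal.toReal_mono hint.ne h1
  rwa [ENNReal.toReal_mul, ENNReal.toReal_ofReal (by positivity)] at h2

/-- The renewal theorem applied to the tilted tail of a solution of the maximum equation. -/
lemma summable_tail_and_tendsto [IsProbabilityMeasure P] (hA : Measurable A) (hB : Measurable B) (hX : Measurable X)
    (hA3 : AssumptionA3 P A κ θ h)
    (hBint : ∃ ν : ℝ, κ < ν ∧ (∫⁻ ω, ENNReal.ofReal (|B ω| ^ ν) ∂P) < ⊤)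
    (hindep : IndepFun (fun ω => (A ω, B ω)) X P)
    (heq : Measure.map X P = Measure.map (fun ω => max (A ω * X ω) (B ω)) P) {x : ℝ}
    (hx : 0 < x) :
    Summable (fun n : ℤ => (x * Real.exp (n * h)) ^ κ *
      (P {ω | X ω > x * Real.exp (n * h)}).toReal) ∧
    Tendsto (fun n : ℤ => (x * Real.exp (n * h)) ^ κ *
      (P {ω | X ω > x * Real.exp (n * h)}).toReal / pA3 P A κ θ h n) atTop
      (𝓝 (θ / (1 - θ) * ∑' n : ℤ, (x * Real.exp (n * h)) ^ κ *
        (P {ω | X ω > x * Real.exp (n * h)}).toReal)) := by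
  have hp := hA3.locallySubexponential hA
  have hθp := ofReal_mul_pA3 hA hA3
  obtain ⟨hκ, hθ, hθ1, hA0, -, ⟨hh, hlat, -⟩, -⟩ := hA3
  obtain ⟨ν, hν, hint⟩ := hBint
  set K := (∫⁻ ω, ENNReal.ofReal (|B ω| ^ ν) ∂P).toReal
  have htpos : ∀ n : ℤ, 0 < x * Real.exp (n * h) := fun n => mul_pos hx (Real.exp_pos _)
  have hprob : ∀ s : Set Ω, (P s).toReal ≤ 1 := fun s =>
    ENNReal.toReal_mono ENNReal.one_ne_top prob_le_one
  set g : ℤ → ℝ := fun n => (x * Real.exp (n * h)) ^ κ *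
    (P {ω | A ω * X ω ≤ x * Real.exp (n * h) ∧ B ω > x * Real.exp (n * h)}).toReal with hg
  have hg0 : ∀ n, 0 ≤ g n := fun n =>
    mul_nonneg (Real.rpow_nonneg (htpos n).le _) ENNReal.toReal_nonneg
  have hgleft : ∀ n, g n ≤ x ^ κ * Real.exp (κ * h * n) := fun n => by
    rw [← mul_exp_rpow hx]
    exact mul_le_of_le_one_right (Real.rpow_nonneg (htpos n).le _) (hprob _)
  have hd : 0 < (ν - κ) * h := mul_pos (sub_pos.2 hν) hh
  have hgright : ∀ n : ℤ, g n ≤ K * x ^ (κ - ν) * Real.exp (-((ν - κ) * h) * n) := fun n => by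
    have h1 := rpow_mul_tail_le hB (hκ.trans hν) hint (htpos n)
    have h2 : (P {ω | A ω * X ω ≤ x * Real.exp (n * h) ∧ B ω > x * Real.exp (n * h)}).toReal ≤
        (P {ω | B ω > x * Real.exp (n * h)}).toReal :=
      ENNReal.toReal_mono (measure_ne_top _ _) (measure_mono fun ω hω => hω.2)
    have h3 : Real.exp (-((ν - κ) * h) * n) = Real.exp ((κ - ν) * h * n) := by congr 1; ring
    have h4 : (x * Real.exp (n * h)) ^ κ =
        (x * Real.exp (n * h)) ^ (κ - ν) * (x * Real.exp (n * h)) ^ ν := by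
      rw [← Real.rpow_add (htpos n), sub_add_cancel]
    rw [h3, mul_assoc K, ← mul_exp_rpow hx]
    calc g n ≤ (x * Real.exp (n * h)) ^ κ * (P {ω | B ω > x * Real.exp (n * h)}).toReal :=
          mul_le_mul_of_nonneg_left h2 (Real.rpow_nonneg (htpos n).le _)
      _ = (x * Real.exp (n * h)) ^ (κ - ν) *
          ((x * Real.exp (n * h)) ^ ν * (P {ω | B ω > x * Real.exp (n * h)}).toReal) := by
          rw [h4]; ring
      _ ≤ (x * Real.exp (n * h)) ^ (κ - ν) * K :=
          mul_le_mul_of_nonneg_left h1 (Real.rpow_nonneg (htpos n).le _)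
      _ = _ := mul_comm _ _
  have hgs : Summable g := by
    refine Summable.of_nat_of_neg ?_ ?_
    · refine Summable.of_nonneg_of_le (fun n => hg0 n) (fun n => hgright n) ?_
      have := (Real.summable_exp_nat_mul_iff.2 (neg_lt_zero.2 hd)).mul_left (K * x ^ (κ - ν))
      simpa [mul_comm] using this
    · refine Summable.of_nonneg_of_le (fun n => hg0 _) (fun n => hgleft _) ?_
      have := (Real.summable_exp_nat_mul_iff.2 (neg_lt_zero.2 (mul_pos hκ hh))).mul_left (x ^ κ)
      simpa [mul_comm] using this
  have hgp : Tendsto (fun n => g n / pA3 P A κ θ h n) atTop (𝓝 0) := by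
    have h1 := (hp.tendsto_exp_div hd).const_mul (K * x ^ (κ - ν))
    rw [mul_zero] at h1
    refine squeeze_zero (fun n => div_nonneg (hg0 n) (hp.nonneg n)) (fun n => ?_) h1
    rw [← mul_div_assoc]
    exact div_le_div_of_nonneg_right (hgright n) (hp.nonneg n)
  refine hp.renewal (w := fun n : ℤ => (x * Real.exp (n * h)) ^ κ) hθ hθ1 hg0 hgs hgp
    (fun n => mul_nonneg (Real.rpow_nonneg (htpos n).le _) ENNReal.toReal_nonneg)
    (fun n => Real.rpow_nonneg (htpos n).le _) (fun n => ?_) (fun n => ?_) (fun ε hε => ?_)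
  · have hofReal : ∀ (m : ℤ) (s : Set Ω), ENNReal.ofReal ((x * Real.exp (m * h)) ^ κ * (P s).toReal) =
        ENNReal.ofReal ((x * Real.exp (m * h)) ^ κ) * P s := fun m s => by
      rw [ENNReal.ofReal_mul (Real.rpow_nonneg (htpos m).le _),
        ENNReal.ofReal_toReal (measure_ne_top _ _)]
    simp only [LocallySubexponential.renewalStep, hg, hofReal]
    conv_lhs => rw [tail_maximum_eq hA hB hX hA0 hh hlat hindep heq (htpos n), mul_add,
      ← ENNReal.tsum_mul_left]
    congr 1
    rw [← (Equiv.subLeft n).tsum_eq]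
    congr 1 with i
    rw [hθp, Equiv.subLeft_apply]
    have e1 : x * Real.exp (n * h) * Real.exp (-(((n - i : ℤ) : ℝ) * h)) =
        x * Real.exp (i * h) := by
      rw [mul_assoc, ← Real.exp_add]
      push_cast
      congr 2; ring
    have e2 : (x * Real.exp (n * h)) ^ κ =
        Real.exp (κ * (((n - i : ℤ) : ℝ) * h)) * (x * Real.exp (i * h)) ^ κ := by
      rw [mul_exp_rpow hx, mul_exp_rpow hx, mul_left_comm, ← Real.exp_add]
      push_cast
      congr 2; ring
    rw [e1, e2, ENNReal.ofReal_mul (Real.exp_pos _).le]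
    ring
  · have e2 : ∀ i : ℤ, ENNReal.ofReal (θ * pA3 P A κ θ h (n - i)) *
        ENNReal.ofReal ((x * Real.exp (i * h)) ^ κ) =
        ENNReal.ofReal ((x * Real.exp (n * h)) ^ κ) *
          P {ω | A ω = Real.exp (((n - i : ℤ) : ℝ) * h)} := fun i => by
      rw [hθp, mul_right_comm, ← ENNReal.ofReal_mul (Real.exp_pos _).le]
      congr 2
      rw [mul_exp_rpow hx, mul_exp_rpow hx, mul_left_comm, ← Real.exp_add]
      push_cast
      congr 2; ring
    simp_rw [e2]
    rw [ENNReal.tsum_mul_left]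
    refine mul_le_of_le_one_right zero_le ?_
    rw [← measure_iUnion]
    · exact prob_le_one
    · intro i j hij
      rw [Function.onFun, Set.disjoint_left]
      intro ω h5 h6
      refine hij ?_
      have h7 := h5.symm.trans h6
      simpa [hh.ne'] using h7
    · exact fun i => hA (measurableSet_singleton _)
  · have htail : Tendsto (fun n : ℕ => P {ω | X ω > x * Real.exp (n * h)}) atTop (𝓝 0) := by
      have h0 : (⋂ n : ℕ, {ω | X ω > x * Real.exp (n * h)}) = ∅ := by
        rw [Set.eq_empty_iff_forall_notMem]
        intro ω hω
        rw [Set.mem_iInter] at hω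
        have h1 : Tendsto (fun n : ℕ => x * Real.exp (n * h)) atTop atTop :=
          (Real.tendsto_exp_atTop.comp
            (tendsto_natCast_atTop_atTop.atTop_mul_const hh)).const_mul_atTop hx
        obtain ⟨n, hn⟩ := (h1.eventually_ge_atTop (X ω)).exists
        exact absurd (hω n) (not_lt.2 hn)
      rw [← measure_empty (μ := P), ← h0]
      refine tendsto_measure_iInter_atTop
        (fun n => (measurableSet_lt measurable_const hX).nullMeasurableSet) ?_
        ⟨0, measure_ne_top _ _⟩
      intro a b hab ω hω
      have hω' : x * Real.exp (b * h) < X ω := hω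
      refine lt_of_le_of_lt ?_ hω'
      gcongr
    have h2 := (ENNReal.tendsto_toReal ENNReal.zero_ne_top).comp htail
    rw [ENNReal.toReal_zero] at h2
    obtain ⟨N, hN⟩ := (h2.eventually_le_const hε).exists
    have hN' : (P {ω | X ω > x * Real.exp (N * h)}).toReal ≤ ε := hN
    refine ⟨(x * Real.exp (N * h)) ^ κ, fun n => ?_⟩
    have hw : 0 ≤ (x * Real.exp (n * h)) ^ κ := Real.rpow_nonneg (htpos n).le _
    rcases le_total n N with hn | hn
    · have hn' : (n : ℝ) ≤ N := by exact_mod_cast hn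
      refine le_trans (mul_le_of_le_one_right hw (hprob _)) (le_trans ?_
        (le_add_of_nonneg_right (by positivity)))
      gcongr
    · have hn' : (N : ℝ) ≤ n := by exact_mod_cast hn
      refine le_trans ?_ (le_add_of_nonneg_left (by positivity))
      rw [mul_comm ε]
      gcongr
      refine le_trans (ENNReal.toReal_mono (measure_ne_top _ _) (measure_mono fun ω hω => ?_)) hN'
      have hω' : x * Real.exp (n * h) < X ω := hω
      refine lt_of_le_of_lt ?_ hω'
      gcongr

end MaximumEquation
/-- Theorem 8: maximum equation `X =_d AX ∨ B` under (A3) and `E|B|^ν < ∞` for some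
`ν > κ`: `p_n⁻¹ x^κ e^{κnh} P(X > x e^{nh}) → q(x)` at continuity points, with `q > 0`
when `B ≥ 0` a.s. and `P(B > 0) > 0`. -/
theorem stmt12 {Ω : Type*} [MeasurableSpace Ω] (P : Measure Ω) [IsProbabilityMeasure P]
    (A B X : Ω → ℝ) (hAmeas : Measurable A) (hBmeas : Measurable B) (hXmeas : Measurable X)
    (κ θ h : ℝ) (hA3 : AssumptionA3 P A κ θ h)
    (hB : ∃ ν : ℝ, κ < ν ∧ (∫⁻ ω, ENNReal.ofReal (|B ω| ^ ν) ∂P) < ⊤)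
    (hindep : IndepFun (fun ω => (A ω, B ω)) X P)
    (heq : Measure.map X P = Measure.map (fun ω => max (A ω * X ω) (B ω)) P) :
    ∃ q : ℝ → ℝ, MemQ κ h q ∧
      (∀ x : ℝ, 0 < x → ContinuousAt q x →
        Tendsto (fun n : ℕ =>
            (pA3 P A κ θ h n)⁻¹ * x ^ κ * Real.exp (κ * (n * h)) *
              (P {ω | X ω > x * Real.exp (n * h)}).toReal)
          atTop (𝓝 (q x))) ∧
      ((∀ᵐ ω ∂P, 0 ≤ B ω) → 0 < P {ω | 0 < B ω} →
        ∀ x : ℝ, 0 < x → 0 < q x) := by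
  have key := fun {x : ℝ} (hx : 0 < x) =>
    summable_tail_and_tendsto hAmeas hBmeas hXmeas hA3 hB hindep heq hx
  obtain ⟨hκ, hθ, hθ1, -, -, ⟨hh, -⟩, -⟩ := hA3
  have h1θ : 0 < θ / (1 - θ) := div_pos hθ (by linarith)
  have hnn : ∀ x : ℝ, 0 < x → ∀ n : ℤ, 0 ≤ (x * Real.exp (n * h)) ^ κ *
      (P {ω | X ω > x * Real.exp (n * h)}).toReal := fun x hx n =>
    mul_nonneg (by positivity) ENNReal.toReal_nonneg
  refine ⟨fun x => θ / (1 - θ) * ∑' n : ℤ, (x * Real.exp (n * h)) ^ κ *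
        (P {ω | X ω > x * Real.exp (n * h)}).toReal, ⟨fun x hx => ?_, ?_, fun x _ => ?_⟩,
    fun x hx _ => ?_, fun _ hBpos x hx => ?_⟩
  · exact mul_nonneg h1θ.le (tsum_nonneg (hnn x hx))
  · have hterm : ∀ x : ℝ, 0 < x → ∀ n : ℤ, x ^ (-κ) * ((x * Real.exp (n * h)) ^ κ *
        (P {ω | X ω > x * Real.exp (n * h)}).toReal) =
        Real.exp (κ * h * n) * (P {ω | X ω > x * Real.exp (n * h)}).toReal := fun x hx n => by
      rw [mul_exp_rpow hx, Real.rpow_neg hx.le]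
      have := Real.rpow_pos_of_pos hx κ
      field_simp
    intro x hx y hy hxy
    dsimp only
    rw [mul_left_comm, mul_left_comm (x ^ (-κ))]
    refine mul_le_mul_of_nonneg_left ?_ h1θ.le
    rw [← tsum_mul_left, ← tsum_mul_left]
    refine Summable.tsum_le_tsum (fun n => ?_) ((key hy).1.mul_left _) ((key hx).1.mul_left _)
    rw [hterm x hx, hterm y hy]
    refine mul_le_mul_of_nonneg_left (ENNReal.toReal_mono (measure_ne_top _ _)
      (measure_mono fun ω hω => ?_)) (Real.exp_pos _).le
    have hω' : y * Real.exp (n * h) < X ω := hω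
    refine lt_of_le_of_lt ?_ hω'
    gcongr
  · dsimp only
    rw [← (Equiv.addRight (1 : ℤ)).tsum_eq fun n : ℤ => (x * Real.exp (n * h)) ^ κ *
        (P {ω | X ω > x * Real.exp (n * h)}).toReal]
    have e1 : ∀ n : ℤ, x * Real.exp h * Real.exp (n * h) =
        x * Real.exp ((Equiv.addRight (1 : ℤ) n : ℤ) * h) := fun n => by
      rw [mul_assoc, ← Real.exp_add, Equiv.coe_addRight]
      push_cast
      congr 2; ring
    simp_rw [e1]
  · refine ((key hx).2.comp tendsto_natCast_atTop_atTop).congr fun n => ?_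
    simp only [Function.comp, Int.cast_natCast]
    rw [mul_exp_rpow hx, div_eq_inv_mul]
    have e1 : κ * h * n = κ * (n * h) := by ring
    rw [e1]
    ring
  · refine mul_pos h1θ ?_
    obtain ⟨n, hn⟩ : ∃ n : ℕ, 0 < P {ω | X ω > x * Real.exp ((-n : ℤ) * h)} := by
      by_contra! hc
      have hmax : Measurable fun ω => max (A ω * X ω) (B ω) := (hAmeas.mul hXmeas).max hBmeas
      have h1 : P {ω | 0 < X ω} = P {ω | 0 < max (A ω * X ω) (B ω)} := by
        have := congrArg (fun μ => μ (Set.Ioi (0 : ℝ))) heq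
        simp only [Measure.map_apply hXmeas measurableSet_Ioi,
          Measure.map_apply hmax measurableSet_Ioi] at this
        exact this
      have h2 : 0 < P {ω | 0 < X ω} := by
        rw [h1]
        exact hBpos.trans_le (measure_mono fun ω (hω : 0 < B ω) =>
          (lt_max_of_lt_right hω : 0 < max (A ω * X ω) (B ω)))
      have h3 : {ω | 0 < X ω} ⊆ ⋃ n : ℕ, {ω | X ω > x * Real.exp ((-n : ℤ) * h)} := by
        intro ω hω
        have h4 : Tendsto (fun n : ℕ => x * Real.exp ((-n : ℤ) * h)) atTop (𝓝 0) := by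
          have := (Real.tendsto_exp_neg_atTop_nhds_zero.comp
            ((tendsto_natCast_atTop_atTop (R := ℝ)).atTop_mul_const hh)).const_mul x
          simpa [Function.comp_def] using this
        obtain ⟨n, hn⟩ := (h4.eventually_lt_const hω).exists
        exact Set.mem_iUnion.2 ⟨n, hn⟩
      exact h2.ne' (measure_mono_null h3 (measure_iUnion_null fun n => nonpos_iff_eq_zero.1 (hc n)))
    exact (key hx).1.tsum_pos (hnn x hx) (-n)
      (mul_pos (by positivity) (ENNReal.toReal_pos hn.ne' (measure_ne_top _ _)))
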